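/- Let X be an n×p real matrix and s₀ an integer with 1 ≤ 3s₀ ≤ p. Suppose Λ_min(2s₀) > 0. Let h ∈ ℝ^p, let T₀ ⊆ {1,…,p} with |T₀| = s₀, let T₁ be a set of indices of the s₀ largest coordinates of h in absolute value outside T₀, and set T₀₁ = T₀ ∪ T₁. Then: (i) ‖h_{T₀₁}‖₂ ≤ (1/√Λ_min(2s₀))·‖Xh‖₂/√n + (θ_{s₀,2s₀}/Λ_min(2s₀))·‖h_{T₀^c}‖₁/√s₀; (ii) ‖h_{T₀₁^c}‖₂² ≤ ‖h_{T₀^c}‖₁²/s₀; and therefore (iii) ‖h‖₂² ≤ ‖h_{T₀₁}‖₂² + ‖h_{T₀^c}‖₁²/s₀. -/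

import Mathlib

open Finset Matrix Real
open scoped BigOperators Classical

noncomputable section

namespace ThreshLasso

/-- ℓ₂ norm of a finite real vector. -/
def l2 {m : ℕ} (v : Fin m → ℝ) : ℝ := Real.sqrt (∑ i, (v i) ^ 2)

/-- ℓ₁ norm of a finite real vector. -/
def l1 {m : ℕ} (v : Fin m → ℝ) : ℝ := ∑ i, |v i|

/-- Restriction of a vector to a set of coordinates (zero outside). -/
def restr {p : ℕ} (v : Fin p → ℝ) (T : Finset (Fin p)) : Fin p → ℝ :=
  fun j => if j ∈ T then v j else 0

/-- Support of a vector, as a `Finset`. -/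
def supp {p : ℕ} (v : Fin p → ℝ) : Finset (Fin p) :=
  Finset.univ.filter fun j => v j ≠ 0

/-- `L` is the minimal `m`-sparse eigenvalue `Λ_min(m)` of `X`:
the least value of `‖Xv‖₂²/(n‖v‖₂²)` over nonzero `v` with at most `m`
nonzero coordinates. -/
def IsLambdaMin {n p : ℕ} (X : Matrix (Fin n) (Fin p) ℝ) (m : ℕ) (L : ℝ) : Prop :=
  IsLeast {r : ℝ | ∃ v : Fin p → ℝ, v ≠ 0 ∧ (supp v).card ≤ m ∧
    r = (l2 (X.mulVec v)) ^ 2 / (n * (l2 v) ^ 2)} L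

/-- `L` is the maximal `m`-sparse eigenvalue `Λ_max(m)` of `X`
(with the convention `Λ_max(0) = 0`, implemented by inserting `0` in the set,
which does not change the maximum when `m ≥ 1`). -/
def IsLambdaMax {n p : ℕ} (X : Matrix (Fin n) (Fin p) ℝ) (m : ℕ) (L : ℝ) : Prop :=
  IsGreatest (insert (0 : ℝ) {r : ℝ | ∃ v : Fin p → ℝ, v ≠ 0 ∧ (supp v).card ≤ m ∧
    r = (l2 (X.mulVec v)) ^ 2 / (n * (l2 v) ^ 2)}) L

/-- `θ` is the restricted orthogonality constant `θ_{m,m'}` of `X`: the smallest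
nonnegative `t` such that `|⟨Xu, Xu'⟩|/n ≤ t‖u‖₂‖u'‖₂` for all `u, u'` supported
on disjoint sets of cardinality at most `m`, `m'` respectively. -/
def IsTheta {n p : ℕ} (X : Matrix (Fin n) (Fin p) ℝ) (m m' : ℕ) (θ : ℝ) : Prop :=
  IsLeast {t : ℝ | 0 ≤ t ∧ ∀ (u u' : Fin p → ℝ) (T T' : Finset (Fin p)),
    Disjoint T T' → T.card ≤ m → T'.card ≤ m' →
    (∀ j, j ∉ T → u j = 0) → (∀ j, j ∉ T' → u' j = 0) →
    |∑ i, (X.mulVec u i) * (X.mulVec u' i)| / n ≤ t * (l2 u * l2 u')} θ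

/-- Restricted eigenvalue condition `RE(s₀, k₀, X)` with constant `K`. -/
def RECond {n p : ℕ} (X : Matrix (Fin n) (Fin p) ℝ) (s₀ : ℕ) (k₀ K : ℝ) : Prop :=
  0 < K ∧ ∀ (v : Fin p → ℝ) (J : Finset (Fin p)), J.card ≤ s₀ →
    l1 (restr v Jᶜ) ≤ k₀ * l1 (restr v J) →
    l2 (restr v J) / K ≤ l2 (X.mulVec v) / Real.sqrt n

/-- `s₀` is the essential sparsity of `β`: the smallest nonnegative integer `m`
with `∑ᵢ min(βᵢ², λ²σ²) ≤ m λ²σ²`. -/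
def EssSparsity {p : ℕ} (β : Fin p → ℝ) (lam σ : ℝ) (s₀ : ℕ) : Prop :=
  IsLeast {m : ℕ | ∑ i, min ((β i) ^ 2) (lam ^ 2 * σ ^ 2) ≤ (m : ℝ) * (lam ^ 2 * σ ^ 2)} s₀

/-- `T₀` is a set of indices of the `s₀` largest coordinates of `β` in absolute value. -/
def TopSet {p : ℕ} (β : Fin p → ℝ) (s₀ : ℕ) (T₀ : Finset (Fin p)) : Prop :=
  T₀.card = s₀ ∧ ∀ i ∈ T₀, ∀ j, j ∉ T₀ → |β j| ≤ |β i|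

/-- `T₁` is a set of indices of the `s₀` largest coordinates of `h` in absolute
value outside `T₀`. -/
def TopSetOutside {p : ℕ} (h : Fin p → ℝ) (s₀ : ℕ) (T₀ T₁ : Finset (Fin p)) : Prop :=
  T₁.card = s₀ ∧ Disjoint T₀ T₁ ∧
    ∀ i ∈ T₁, ∀ j, j ∉ T₀ → j ∉ T₁ → |h j| ≤ |h i|

/-- `b` is a Lasso minimizer with penalty `lamn` for data `(X, Y)`. -/
def IsLassoSol {n p : ℕ} (X : Matrix (Fin n) (Fin p) ℝ) (Y : Fin n → ℝ)
    (lamn : ℝ) (b : Fin p → ℝ) : Prop :=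
  ∀ b' : Fin p → ℝ,
    1 / (2 * n) * (l2 (Y - X.mulVec b)) ^ 2 + lamn * l1 b ≤
    1 / (2 * n) * (l2 (Y - X.mulVec b')) ^ 2 + lamn * l1 b'

/-- Submatrix of the columns of `X` indexed by `I`. -/
def colSub {n p : ℕ} (X : Matrix (Fin n) (Fin p) ℝ) (I : Finset (Fin p)) :
    Matrix (Fin n) {j // j ∈ I} ℝ :=
  Matrix.of fun i j => X i j.1

/-- The Gram matrix `X_Iᵀ X_I` is invertible. -/
def GramInvertible {n p : ℕ} (X : Matrix (Fin n) (Fin p) ℝ) (I : Finset (Fin p)) : Prop :=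
  IsUnit ((colSub X I)ᵀ * colSub X I).det

/-- The OLS refit of `Y` on the columns of `X` indexed by `I`:
`(X_Iᵀ X_I)⁻¹ X_Iᵀ Y` on `I`, and `0` off `I`. -/
def olsRefit {n p : ℕ} (X : Matrix (Fin n) (Fin p) ℝ) (Y : Fin n → ℝ)
    (I : Finset (Fin p)) : Fin p → ℝ :=
  fun j => if h : j ∈ I then
    (((colSub X I)ᵀ * colSub X I)⁻¹).mulVec ((colSub X I)ᵀ.mulVec Y) ⟨j, h⟩
  else 0


theorem l1_restr {p : ℕ} (v : Fin p → ℝ) (T : Finset (Fin p)) :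
    l1 (restr v T) = ∑ i ∈ T, |v i| := by
  simp [l1, restr, apply_ite abs, Finset.sum_ite_mem]

theorem l2_sq {m : ℕ} (v : Fin m → ℝ) : l2 v ^ 2 = ∑ i, v i ^ 2 :=
  Real.sq_sqrt (Finset.sum_nonneg fun i _ => sq_nonneg (v i))

theorem l2_nonneg {m : ℕ} (v : Fin m → ℝ) : 0 ≤ l2 v := Real.sqrt_nonneg _

theorem l2_restr_sq {p : ℕ} (v : Fin p → ℝ) (T : Finset (Fin p)) :
    l2 (restr v T) ^ 2 = ∑ i ∈ T, v i ^ 2 := by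
  simp [l2_sq, restr, ite_pow, Finset.sum_ite_mem]

theorem restr_union {p : ℕ} (v : Fin p → ℝ) {S T : Finset (Fin p)} (hST : Disjoint S T) :
    restr v (S ∪ T) = restr v S + restr v T := by
  ext j
  have : j ∈ S → j ∉ T := fun hS => Finset.disjoint_left.mp hST hS
  by_cases hS : j ∈ S <;> by_cases hT : j ∈ T <;> simp_all [restr]

theorem restr_add_restr_compl {p : ℕ} (v : Fin p → ℝ) (T : Finset (Fin p)) :
    restr v T + restr v Tᶜ = v := by
  ext j
  by_cases hT : j ∈ T <;> simp [restr, hT]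

theorem card_supp_restr_le {p : ℕ} (v : Fin p → ℝ) (T : Finset (Fin p)) :
    (supp (restr v T)).card ≤ T.card := by
  refine Finset.card_le_card fun j hj => ?_
  by_contra hT
  simp [supp, restr, hT] at hj

theorem abs_inner_le {m : ℕ} (u v : Fin m → ℝ) : |∑ i, u i * v i| ≤ l2 u * l2 v := by
  refine abs_le_of_sq_le_sq ?_ (mul_nonneg (l2_nonneg u) (l2_nonneg v))
  rw [mul_pow, l2_sq, l2_sq]
  exact Finset.sum_mul_sq_le_sq_mul_sq _ _ _

theorem IsLambdaMin.mul_sq_le {n p m : ℕ} {X : Matrix (Fin n) (Fin p) ℝ} {L : ℝ}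
    (hL : IsLambdaMin X m L) (hn : 0 < n) {v : Fin p → ℝ} (hv : (supp v).card ≤ m) :
    L * l2 v ^ 2 ≤ l2 (X.mulVec v) ^ 2 / n := by
  have hn' : (0 : ℝ) < n := Nat.cast_pos.mpr hn
  by_cases h0 : v = 0
  · have : l2 v = 0 := by simp [h0, l2]
    rw [this]
    simp only [ne_eq, OfNat.ofNat_ne_zero, not_false_eq_true, zero_pow, mul_zero]
    positivity
  · have hpos : 0 < l2 v ^ 2 := by
      rw [l2_sq]
      obtain ⟨j, hj⟩ := Function.ne_iff.mp h0
      have hj' : v j ≠ 0 := hj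
      exact Finset.sum_pos' (fun i _ => sq_nonneg (v i))
        ⟨j, Finset.mem_univ j, by positivity⟩
    have := hL.2 ⟨v, h0, hv, rfl⟩
    rw [le_div_iff₀ (by positivity)] at this
    rw [le_div_iff₀ hn']
    linarith

/-- A finite set contains a subset of any smaller size on which `f` is largest. -/
theorem exists_top_subset {α : Type*} [DecidableEq α] (f : α → ℝ) (A : Finset α) (k : ℕ)
    (hk : k ≤ A.card) :
    ∃ V ⊆ A, V.card = k ∧ ∀ i ∈ V, ∀ j ∈ A \ V, f j ≤ f i := by
  induction k with
  | zero => exact ⟨∅, by simp⟩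
  | succ k ih =>
    obtain ⟨V, hVA, hVk, hV⟩ := ih (by omega)
    have hne : (A \ V).Nonempty := by
      rw [← Finset.card_pos, Finset.card_sdiff_of_subset hVA]
      omega
    obtain ⟨a, ha, hmax⟩ := Finset.exists_max_image (A \ V) f hne
    have ha' := Finset.mem_sdiff.mp ha
    refine ⟨insert a V, Finset.insert_subset ha'.1 hVA, by simp [ha'.2, hVk], ?_⟩
    intro i hi j hj
    have hj' : j ∈ A \ V := by
      simp only [Finset.mem_sdiff, Finset.mem_insert] at hj ⊢
      tauto
    rcases Finset.mem_insert.mp hi with rfl | hi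
    · exact hmax j hj'
    · exact hV i hi j hj'

/-- If every entry on `A` is dominated by every entry on `U`, it is at most the mean over `U`. -/
theorem mul_abs_le_sum_abs {p : ℕ} {h : Fin p → ℝ} {U A : Finset (Fin p)}
    (hUA : ∀ i ∈ U, ∀ j ∈ A, |h j| ≤ |h i|) {j : Fin p} (hj : j ∈ A) :
    U.card * |h j| ≤ ∑ i ∈ U, |h i| := by
  simpa using Finset.card_nsmul_le_sum U (fun i => |h i|) |h j| fun i hi => hUA i hi j hj

theorem sum_sq_le_of_dominated {p : ℕ} {h : Fin p → ℝ} {U A : Finset (Fin p)}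
    (hUA : ∀ i ∈ U, ∀ j ∈ A, |h j| ≤ |h i|) :
    U.card * ∑ j ∈ A, h j ^ 2 ≤ (∑ i ∈ U, |h i|) * ∑ j ∈ A, |h j| := by
  rw [Finset.mul_sum, Finset.mul_sum]
  refine Finset.sum_le_sum fun j hj => ?_
  have := mul_le_mul_of_nonneg_right (mul_abs_le_sum_abs hUA hj) (abs_nonneg (h j))
  rwa [mul_assoc, abs_mul_abs_self, ← pow_two] at this

theorem l2_restr_le_of_dominated {p : ℕ} {h : Fin p → ℝ} {U A : Finset (Fin p)} {s : ℕ}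
    (hs : 1 ≤ s) (hU : U.card = s) (hA : A.card ≤ s)
    (hUA : ∀ i ∈ U, ∀ j ∈ A, |h j| ≤ |h i|) :
    l2 (restr h A) ≤ (∑ i ∈ U, |h i|) / √s := by
  have hs' : (0 : ℝ) < s := by exact_mod_cast hs
  have hB : 0 ≤ ∑ i ∈ U, |h i| := Finset.sum_nonneg fun i _ => abs_nonneg (h i)
  refine (sq_le_sq₀ (l2_nonneg _) (by positivity)).mp ?_
  rw [l2_restr_sq, div_pow, Real.sq_sqrt hs'.le, le_div_iff₀ hs', mul_comm]
  have h1 := sum_sq_le_of_dominated hUA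
  have h2 : ∑ j ∈ A, |h j| ≤ ∑ i ∈ U, |h i| := by
    have h3 : ∑ j ∈ A, (s : ℝ) * |h j| ≤ A.card * ∑ i ∈ U, |h i| := by
      rw [← nsmul_eq_mul]
      refine Finset.sum_le_card_nsmul _ _ _ fun j hj => ?_
      have := mul_abs_le_sum_abs hUA hj
      rwa [hU] at this
    have h4 : (A.card : ℝ) * ∑ i ∈ U, |h i| ≤ s * ∑ i ∈ U, |h i| := by gcongr
    rw [← Finset.mul_sum] at h3
    exact le_of_mul_le_mul_left (h3.trans h4) hs'
  rw [hU] at h1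
  nlinarith

/-- Shelling argument: a subadditive set function controlled by `C * l2` on blocks of size at
most `s` is controlled by `C * l1 / √s` on arbitrary sets, once a block `U` of `s` entries
dominating the set is added. -/
theorem subadditive_le_of_dominated {p : ℕ} {h : Fin p → ℝ} {s : ℕ} (hs : 1 ≤ s)
    {f : Finset (Fin p) → ℝ} {C : ℝ} (hC : 0 ≤ C)
    (hadd : ∀ S T, Disjoint S T → f (S ∪ T) ≤ f S + f T)
    (A U : Finset (Fin p)) (hU : U.card = s) (hUA : ∀ i ∈ U, ∀ j ∈ A, |h j| ≤ |h i|)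
    (hblock : ∀ V ⊆ A, V.card ≤ s → f V ≤ C * l2 (restr h V)) :
    f A ≤ C * ((∑ i ∈ U, |h i| + ∑ i ∈ A, |h i|) / √s) := by
  induction A using Finset.strongInduction generalizing U with
  | H A ih =>
    by_cases hA : A.card ≤ s
    · refine (hblock A subset_rfl hA).trans ?_
      gcongr
      refine (l2_restr_le_of_dominated hs hU hA hUA).trans ?_
      gcongr
      exact le_add_of_nonneg_right (Finset.sum_nonneg fun i _ => abs_nonneg (h i))
    · obtain ⟨V, hVA, hVs, hV⟩ := exists_top_subset (fun i => |h i|) A s (by omega)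
      have hVne : V.Nonempty := Finset.card_pos.mp (by omega)
      have h1 := ih (A \ V) (Finset.sdiff_ssubset hVA hVne) V hVs hV
        fun W hW => hblock W (hW.trans Finset.sdiff_subset)
      have h2 := hadd V (A \ V) Finset.disjoint_sdiff
      rw [Finset.union_sdiff_of_subset hVA] at h2
      have h3 : f V ≤ C * ((∑ i ∈ U, |h i|) / √s) :=
        (hblock V hVA hVs.le).trans <| mul_le_mul_of_nonneg_left
          (l2_restr_le_of_dominated hs hU hVs.le fun i hi j hj => hUA i hi j (hVA hj)) hC
      have h4 : ∑ i ∈ V, |h i| + ∑ i ∈ A \ V, |h i| = ∑ i ∈ A, |h i| := by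
        rw [add_comm, Finset.sum_sdiff hVA]
      rw [h4] at h1
      rw [add_div, mul_add]
      linarith

theorem le_of_sq_le_mul_add {L x a b c : ℝ} (hL : 0 < L) (hx : 0 ≤ x) (ha : 0 ≤ a)
    (hb : 0 ≤ b) (hc : 0 ≤ c) (hLx : L * x ^ 2 ≤ a ^ 2) (hab : a ^ 2 ≤ a * b + c * x) :
    x ≤ 1 / √L * b + c / L := by
  have hq : 0 < √L := Real.sqrt_pos.mpr hL
  have hqq : √L ^ 2 = L := Real.sq_sqrt hL.le
  have h1 : √L * x ≤ a := by
    refine abs_le_of_sq_le_sq' ?_ ha |>.2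
    rw [mul_pow, hqq]
    exact hLx
  have h2 : √L * a ≤ √L * b + c := by
    rcases ha.eq_or_lt with rfl | ha'
    · simpa using by positivity
    · refine le_of_mul_le_mul_left ?_ ha'
      nlinarith [mul_le_mul_of_nonneg_left h1 hc]
  have h3 : x * L ≤ √L * b + c := by nlinarith
  have h4 : 1 / √L * b + c / L = (√L * b + c) / L := by
    rw [← Real.sqrt_div_self']
    ring
  rw [h4, le_div_iff₀ hL]
  exact h3

/-- bounds on `h_{T₀₁}`, `h_{T₀₁ᶜ}` and `h` (Candès–Tao style lemma). -/
theorem statement_7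
    (n p s₀ : ℕ) (hn : 0 < n) (hs₀ : 1 ≤ s₀) (h3s₀ : 3 * s₀ ≤ p)
    (X : Matrix (Fin n) (Fin p) ℝ)
    (Lmin2s0 : ℝ) (hLmin : IsLambdaMin X (2 * s₀) Lmin2s0) (hpos : 0 < Lmin2s0)
    (h : Fin p → ℝ)
    (T₀ : Finset (Fin p)) (hT₀ : T₀.card = s₀)
    (T₁ : Finset (Fin p)) (hT₁ : TopSetOutside h s₀ T₀ T₁)
    (T₀₁ : Finset (Fin p)) (hT₀₁ : T₀₁ = T₀ ∪ T₁)
    (θ : ℝ) (hθ : IsTheta X s₀ (2 * s₀) θ) :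
    l2 (restr h T₀₁) ≤
      (1 / Real.sqrt Lmin2s0) * (l2 (X.mulVec h) / Real.sqrt n) +
        (θ / Lmin2s0) * (l1 (restr h T₀ᶜ) / Real.sqrt s₀) ∧
    (l2 (restr h T₀₁ᶜ)) ^ 2 ≤ (l1 (restr h T₀ᶜ)) ^ 2 / s₀ ∧
    (l2 h) ^ 2 ≤ (l2 (restr h T₀₁)) ^ 2 + (l1 (restr h T₀ᶜ)) ^ 2 / s₀ := by
  obtain ⟨hT₁c, hdisj, htop⟩ := hT₁
  have hn' : (0 : ℝ) < n := Nat.cast_pos.mpr hn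
  have hs' : (0 : ℝ) < s₀ := by exact_mod_cast hs₀
  have hdom : ∀ i ∈ T₁, ∀ j ∈ T₀₁ᶜ, |h j| ≤ |h i| := by
    intro i hi j hj
    simp only [hT₀₁, Finset.mem_compl, Finset.mem_union, not_or] at hj
    exact htop i hi j hj.1 hj.2
  have hsum : l1 (restr h T₀ᶜ) = ∑ i ∈ T₁, |h i| + ∑ i ∈ T₀₁ᶜ, |h i| := by
    have hset : T₀ᶜ = T₁ ∪ T₀₁ᶜ := by
      ext j
      have : j ∈ T₀ → j ∉ T₁ := fun h₀ => Finset.disjoint_left.mp hdisj h₀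
      simp only [hT₀₁, Finset.mem_compl, Finset.mem_union]
      tauto
    rw [l1_restr, hset, Finset.sum_union]
    rw [Finset.disjoint_left]
    intro j hj
    simp [hT₀₁, hj]
  have hcard : T₀₁.card ≤ 2 * s₀ := by
    rw [hT₀₁]
    exact (Finset.card_union_le _ _).trans (by omega)
  have htail : l2 (restr h T₀₁ᶜ) ^ 2 ≤ l1 (restr h T₀ᶜ) ^ 2 / s₀ := by
    rw [l2_restr_sq, le_div_iff₀ hs', mul_comm, hsum]
    have h1 := sum_sq_le_of_dominated hdom
    rw [hT₁c] at h1
    have hU : 0 ≤ ∑ i ∈ T₁, |h i| := Finset.sum_nonneg fun i _ => abs_nonneg (h i)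
    have hA : 0 ≤ ∑ i ∈ T₀₁ᶜ, |h i| := Finset.sum_nonneg fun i _ => abs_nonneg (h i)
    nlinarith
  refine ⟨?_, htail, ?_⟩
  · set y := restr h T₀₁ with hy
    have hblock : ∀ V ⊆ T₀₁ᶜ, V.card ≤ s₀ →
        |∑ i, X.mulVec (restr h V) i * X.mulVec y i| / n ≤ θ * l2 y * l2 (restr h V) := by
      intro V hV hVs
      have := hθ.1.2 (restr h V) y V T₀₁
        (Finset.disjoint_left.mpr fun j hj => Finset.mem_compl.mp (hV hj)) hVs hcard
        (fun j hj => by simp [restr, hj]) (fun j hj => by simp [hy, restr, hj])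
      linarith
    have hshell := subadditive_le_of_dominated (h := h) hs₀
      (f := fun V => |∑ i, X.mulVec (restr h V) i * X.mulVec y i| / n)
      (mul_nonneg hθ.1.1 (l2_nonneg y))
      (fun S T hST => by
        rw [restr_union h hST, Matrix.mulVec_add, ← add_div]
        simp only [Pi.add_apply, add_mul, Finset.sum_add_distrib]
        gcongr
        exact abs_add_le _ _)
      T₀₁ᶜ T₁ hT₁c hdom hblock
    rw [← hsum] at hshell
    have hl1 : 0 ≤ l1 (restr h T₀ᶜ) := Finset.sum_nonneg fun i _ => abs_nonneg _
    have hmain := hLmin.mul_sq_le hn ((card_supp_restr_le h T₀₁).trans hcard)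
    have hsplit : l2 (X.mulVec y) ^ 2 = ∑ i, X.mulVec y i * X.mulVec h i -
        ∑ i, X.mulVec (restr h T₀₁ᶜ) i * X.mulVec y i := by
      rw [l2_sq, ← Finset.sum_sub_distrib]
      refine Finset.sum_congr rfl fun i _ => ?_
      have : X.mulVec h i = X.mulVec y i + X.mulVec (restr h T₀₁ᶜ) i := by
        rw [← Pi.add_apply, ← Matrix.mulVec_add, restr_add_restr_compl]
      rw [this]
      ring
    have hfinal : (l2 (X.mulVec y) / √n) ^ 2 ≤
        l2 (X.mulVec y) / √n * (l2 (X.mulVec h) / √n) +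
          θ * (l1 (restr h T₀ᶜ) / √s₀) * l2 y := by
      have h1 : l2 (X.mulVec y) / √n * (l2 (X.mulVec h) / √n) =
          l2 (X.mulVec y) * l2 (X.mulVec h) / n := by
        rw [div_mul_div_comm, Real.mul_self_sqrt hn'.le]
      have h2 : l2 (X.mulVec y) ^ 2 / n ≤ l2 (X.mulVec y) * l2 (X.mulVec h) / n +
          |∑ i, X.mulVec (restr h T₀₁ᶜ) i * X.mulVec y i| / n := by
        rw [← add_div, hsplit]
        gcongr
        linarith [le_abs_self (∑ i, X.mulVec y i * X.mulVec h i),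
          abs_inner_le (X.mulVec y) (X.mulVec h),
          neg_abs_le (∑ i, X.mulVec (restr h T₀₁ᶜ) i * X.mulVec y i)]
      rw [h1, div_pow, Real.sq_sqrt hn'.le]
      linarith
    have := le_of_sq_le_mul_add hpos (l2_nonneg y)
      (div_nonneg (l2_nonneg (X.mulVec y)) (Real.sqrt_nonneg n))
      (div_nonneg (l2_nonneg (X.mulVec h)) (Real.sqrt_nonneg n))
      (mul_nonneg hθ.1.1 (div_nonneg hl1 (Real.sqrt_nonneg s₀)))
      (by rwa [div_pow, Real.sq_sqrt hn'.le]) hfinal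
    rwa [mul_div_right_comm] at this
  · have : l2 h ^ 2 = l2 (restr h T₀₁) ^ 2 + l2 (restr h T₀₁ᶜ) ^ 2 := by
      rw [l2_restr_sq, l2_restr_sq, l2_sq, Finset.sum_add_sum_compl]
    linarith

end ThreshLasso
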